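/- arXiv:1508.06188 — 4 statements merged into one kernel-verified Lean document; each statement's English description precedes it below -/
import Mathlib

section
/- Let n ≥ 1 and k = 2n+1. If A ∈ M_k(ℂ) satisfies det A = 1 and Aᵀ J_k A = J_k (i.e., A is special orthogonal with respect to the symmetric form J_k), then for every pair of subsets S, T ⊆ {1,…,k} of the same cardinality, the minors satisfy A_{S,T} = A_{ι(S̄), ι(T̄)}. -/
open Matrix

/-- The antidiagonal matrix `J_k` with `(J_k)_{i, k+1-i} = (-1)^(i-1)` (1-indexed). -/
noncomputable def Jmat (k : ℕ) : Matrix (Fin k) (Fin k) ℂ :=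
  Matrix.of fun i j => if (i : ℕ) + (j : ℕ) + 1 = k then (-1 : ℂ) ^ (i : ℕ) else 0

/-- The minor `A_{S,T}` of `A` with rows `S` and columns `T` in increasing order
(`0` if the cardinalities differ). -/
noncomputable def gminor {k : ℕ} (A : Matrix (Fin k) (Fin k) ℂ)
    (S T : Finset (Fin k)) : ℂ :=
  if h : T.card = S.card then
    Matrix.det (Matrix.of fun i j : Fin S.card =>
      A (S.orderIsoOfFin rfl i) (T.orderIsoOfFin h j))
  else 0

namespace Matrix

variable {R : Type*} [CommRing R]

/-- Jacobi's identity for complementary minors, for arbitrary splittings of the index type. -/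
theorem det_submatrix_inl_of_mul_eq_one {α β κ : Type*} [Fintype α] [Fintype β] [Fintype κ]
    [DecidableEq α] [DecidableEq β] [DecidableEq κ] {A B : Matrix κ κ R} (h : A * B = 1)
    (e f : α ⊕ β ≃ κ) :
    (A.submatrix (e ∘ Sum.inl) (f ∘ Sum.inl)).det =
      (A.submatrix e f).det * (B.submatrix (f ∘ Sum.inr) (e ∘ Sum.inr)).det := by
  set M := A.submatrix e f with hM
  set N := B.submatrix f e with hN
  have hMN : M * N = 1 := by
    rw [hM, hN, submatrix_mul_equiv, h, submatrix_one_equiv]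
  rw [← fromBlocks_toBlocks M, ← fromBlocks_toBlocks N, fromBlocks_multiply,
    ← fromBlocks_one, fromBlocks_inj] at hMN
  obtain ⟨-, h₁₂, -, h₂₂⟩ := hMN
  have key : M * fromBlocks 1 N.toBlocks₁₂ 0 N.toBlocks₂₂ =
      fromBlocks M.toBlocks₁₁ 0 M.toBlocks₂₁ 1 := by
    conv_lhs => rw [← fromBlocks_toBlocks M]
    rw [fromBlocks_multiply, h₁₂, h₂₂]
    simp
  have := congrArg det key
  rw [det_mul, det_fromBlocks_zero₂₁, det_fromBlocks_zero₁₂, det_one, det_one, one_mul,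
    mul_one] at this
  exact this.symm

theorem det_submatrix_equiv_equiv {α κ : Type*} [Fintype α] [Fintype κ]
    [DecidableEq α] [DecidableEq κ] (A : Matrix κ κ R) (e f : α ≃ κ) :
    (A.submatrix e f).det = (Equiv.Perm.sign (f.trans e.symm) : ℤ) * A.det := by
  have : A.submatrix e f = (A.submatrix e e).submatrix id (f.trans e.symm) := by
    ext i j; simp
  rw [this, det_permute', det_submatrix_equiv_self]

end Matrix

theorem orderEmbOfFin_ne_orderEmbOfFin_compl {k m n : ℕ} {S : Finset (Fin k)}
    (hS : S.card = m) (hS' : Sᶜ.card = n) (i : Fin m) (j : Fin n) :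
    S.orderEmbOfFin hS i ≠ Sᶜ.orderEmbOfFin hS' j := by
  intro h
  have h' := Finset.orderEmbOfFin_mem Sᶜ hS' j
  rw [← h, Finset.mem_compl] at h'
  exact h' (Finset.orderEmbOfFin_mem S hS i)

/-- The number of inversions of a shuffle that involve a fixed element of the second block. -/
theorem card_orderEmbOfFin_gt {k m n : ℕ} {S : Finset (Fin k)} (hS : S.card = m)
    (hS' : Sᶜ.card = n) (j : Fin n) :
    (Finset.univ.filter fun i : Fin m => Sᶜ.orderEmbOfFin hS' j < S.orderEmbOfFin hS i).card
      + (Sᶜ.orderEmbOfFin hS' j : ℕ) = m + j := by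
  set x := Sᶜ.orderEmbOfFin hS' j with hx
  have h₁ : (∑ y : Fin k, if y < x then 1 else 0) = (x : ℕ) := by
    rw [← Finset.card_filter, Finset.filter_gt_eq_Iio, Fin.card_Iio]
  have h₂ : (∑ i : Fin n, if i < j then 1 else 0) = (j : ℕ) := by
    rw [← Finset.card_filter, Finset.filter_gt_eq_Iio, Fin.card_Iio]
  rw [← (finSumEquivOfFinset hS hS').sum_comp, Fintype.sum_sum_type] at h₁
  simp only [finSumEquivOfFinset_inl, finSumEquivOfFinset_inr, hx, OrderEmbedding.lt_iff_lt,
    h₂] at h₁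
  rw [← hx] at h₁
  have h₃ : ∀ i : Fin m, (if x < S.orderEmbOfFin hS i then 1 else 0) +
      (if S.orderEmbOfFin hS i < x then 1 else 0) = 1 := by
    intro i
    have hne : S.orderEmbOfFin hS i ≠ x := orderEmbOfFin_ne_orderEmbOfFin_compl hS hS' i j
    rcases lt_or_gt_of_ne hne with h | h <;> simp [h, h.not_gt]
  have h₄ := Finset.sum_congr (rfl : (Finset.univ : Finset (Fin m)) = Finset.univ)
    fun i _ => h₃ i
  rw [Finset.sum_add_distrib] at h₄
  rw [Finset.card_filter]
  simp only [Finset.sum_const, Finset.card_univ, Fintype.card_fin, smul_eq_mul, mul_one] at h₄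
  omega

theorem sign_finSumEquivOfFinset {m n : ℕ} {S : Finset (Fin (m + n))} (hS : S.card = m)
    (hS' : Sᶜ.card = n) :
    Equiv.Perm.sign (finSumFinEquiv.symm.trans (finSumEquivOfFinset hS hS')) =
      ∏ j : Fin n, (-1) ^ (m + j + (Sᶜ.orderEmbOfFin hS' j : ℕ)) := by
  rw [Equiv.Perm.sign_eq_prod_prod_Iio]
  have : ∀ j, ∏ i ∈ Finset.Iio j,
      (if finSumFinEquiv.symm.trans (finSumEquivOfFinset hS hS') i <
        finSumFinEquiv.symm.trans (finSumEquivOfFinset hS hS') j then (1 : ℤˣ) else -1) =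
      ∏ i, if i < j then (if finSumFinEquiv.symm.trans (finSumEquivOfFinset hS hS') i <
        finSumFinEquiv.symm.trans (finSumEquivOfFinset hS hS') j then 1 else -1) else 1 := by
    intro j
    rw [← Finset.prod_filter]
    congr 1
    ext; simp
  rw [Finset.prod_congr rfl fun j _ => this j]
  simp only [Fin.prod_univ_add, Equiv.trans_apply, finSumFinEquiv_symm_apply_castAdd,
    finSumFinEquiv_symm_apply_natAdd, finSumEquivOfFinset_inl, finSumEquivOfFinset_inr,
    OrderEmbedding.lt_iff_lt]
  have hnot (j : Fin m) (i : Fin n) : ¬ Fin.natAdd m i < Fin.castAdd n j := by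
    simp [Fin.lt_def]; omega
  have hlt (i : Fin m) (j : Fin n) : Fin.castAdd n i < Fin.natAdd m j := by
    simp [Fin.lt_def]; omega
  have hsame {p : ℕ} (i j : Fin p) :
      (if i < j then (if i < j then (1 : ℤˣ) else -1) else 1) = 1 := by
    split_ifs <;> rfl
  have hcast (i j : Fin m) : Fin.castAdd n i < Fin.castAdd n j ↔ i < j := Iff.rfl
  simp only [hnot, hlt, if_true, if_false, hcast, Fin.natAdd_lt_natAdd_iff,
    hsame, Finset.prod_const_one, one_mul, mul_one]
  refine Finset.prod_congr rfl fun j _ => ?_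
  have hc := card_orderEmbOfFin_gt hS hS' j
  have hflip (i : Fin m) :
      (if S.orderEmbOfFin hS i < Sᶜ.orderEmbOfFin hS' j then (1 : ℤˣ) else -1) =
        if Sᶜ.orderEmbOfFin hS' j < S.orderEmbOfFin hS i then -1 else 1 := by
    rcases lt_or_gt_of_ne (orderEmbOfFin_ne_orderEmbOfFin_compl hS hS' i j) with h | h <;> simp [h, h.not_gt]
  simp only [hflip]
  rw [← Finset.prod_filter, Finset.prod_const, ← hc, add_assoc, pow_add, ← two_mul, pow_mul]
  simp

theorem sign_finSumEquivOfFinset_trans_symm {k m n : ℕ} {S T : Finset (Fin k)}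
    (hS : S.card = m) (hS' : Sᶜ.card = n) (hT : T.card = m) (hT' : Tᶜ.card = n) :
    Equiv.Perm.sign ((finSumEquivOfFinset hT hT').trans (finSumEquivOfFinset hS hS').symm) =
      (∏ j : Fin n, (-1) ^ (Tᶜ.orderEmbOfFin hT' j : ℕ)) *
        ∏ j : Fin n, (-1) ^ (Sᶜ.orderEmbOfFin hS' j : ℕ) := by
  obtain rfl : k = m + n := by
    rw [← hS, ← hS', Finset.card_add_card_compl, Fintype.card_fin]
  have h : Equiv.Perm.sign
      ((finSumEquivOfFinset hT hT').trans (finSumEquivOfFinset hS hS').symm) =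
      Equiv.Perm.sign (finSumFinEquiv.symm.trans (finSumEquivOfFinset hT hT')) *
        Equiv.Perm.sign (finSumFinEquiv.symm.trans (finSumEquivOfFinset hS hS')) := by
    rw [← Equiv.Perm.sign_symm_trans_trans _ finSumFinEquiv,
      ← Equiv.Perm.sign_symm (finSumFinEquiv.symm.trans (finSumEquivOfFinset hS hS')),
      mul_comm, ← Equiv.Perm.sign_mul]
    congr 1
  rw [h, sign_finSumEquivOfFinset, sign_finSumEquivOfFinset, ← Finset.prod_mul_distrib,
    ← Finset.prod_mul_distrib]
  refine Finset.prod_congr rfl fun j _ => ?_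
  rw [pow_add, pow_add _ (m + _), mul_mul_mul_comm, ← pow_add, ← two_mul, pow_mul]
  simp

theorem gminor_eq_det_submatrix {k m : ℕ} (A : Matrix (Fin k) (Fin k) ℂ) {S T : Finset (Fin k)}
    (hS : S.card = m) (hT : T.card = m) :
    gminor A S T = (A.submatrix (S.orderEmbOfFin hS) (T.orderEmbOfFin hT)).det := by
  subst hS
  rw [gminor, dif_pos hT]
  rfl

theorem orderEmbOfFin_image_rev {k m : ℕ} {S : Finset (Fin k)} (hS : S.card = m)
    (hS' : (S.image Fin.rev).card = m) (i : Fin m) :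
    (S.image Fin.rev).orderEmbOfFin hS' i = Fin.rev (S.orderEmbOfFin hS (Fin.rev i)) := by
  have := Finset.orderEmbOfFin_unique hS'
    (f := fun i => Fin.rev (S.orderEmbOfFin hS (Fin.rev i)))
    (fun i => Finset.mem_image_of_mem _ (Finset.orderEmbOfFin_mem S hS _))
    (fun i j hij => by simpa using hij)
  exact (congrFun this i).symm

theorem gminor_image_rev {k : ℕ} (A : Matrix (Fin k) (Fin k) ℂ) {S T : Finset (Fin k)} {m : ℕ}
    (hS : S.card = m) (hT : T.card = m) :
    gminor A (S.image Fin.rev) (T.image Fin.rev) =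
      (A.submatrix (fun i => Fin.rev (S.orderEmbOfFin hS i))
        (fun j => Fin.rev (T.orderEmbOfFin hT j))).det := by
  have hS' : (S.image Fin.rev).card = m := by
    rw [Finset.card_image_of_injective _ Fin.rev_injective, hS]
  have hT' : (T.image Fin.rev).card = m := by
    rw [Finset.card_image_of_injective _ Fin.rev_injective, hT]
  rw [gminor_eq_det_submatrix A hS' hT', ← det_submatrix_equiv_self Fin.revPerm]
  congr 1
  ext i j
  simp [orderEmbOfFin_image_rev hS, orderEmbOfFin_image_rev hT]

theorem Jmat_apply_left {k : ℕ} (i j : Fin k) :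
    Jmat k i j = if j = Fin.rev i then (-1) ^ (i : ℕ) else 0 := by
  have : (i : ℕ) + j + 1 = k ↔ j = Fin.rev i := by
    rw [Fin.ext_iff, Fin.val_rev]; omega
  simp [Jmat, this]

theorem Jmat_apply_right {n : ℕ} (i j : Fin (2 * n + 1)) :
    Jmat (2 * n + 1) i j = if i = Fin.rev j then (-1) ^ (j : ℕ) else 0 := by
  have h : (i : ℕ) + j + 1 = 2 * n + 1 ↔ i = Fin.rev j := by
    rw [Fin.ext_iff, Fin.val_rev]; omega
  simp only [Jmat, Matrix.of_apply, h]
  split_ifs with hij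
  · rw [neg_one_pow_congr]
    have := h.2 hij
    grind
  · rfl

theorem Jmat_mul_self (n : ℕ) : Jmat (2 * n + 1) * Jmat (2 * n + 1) = 1 := by
  ext i j
  rw [Matrix.mul_apply]
  simp only [Jmat_apply_left (k := 2 * n + 1) i, Jmat_apply_right _ j, ite_mul, zero_mul,
    Finset.sum_ite_eq', Finset.mem_univ, if_true, Fin.rev_inj,
    Matrix.one_apply]
  split_ifs with h
  · rw [h, ← pow_add, ← two_mul, pow_mul]; simp
  · simp

theorem Jmat_conj_apply {n : ℕ} (A : Matrix (Fin (2 * n + 1)) (Fin (2 * n + 1)) ℂ)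
    (i j : Fin (2 * n + 1)) :
    (Jmat (2 * n + 1) * A * Jmat (2 * n + 1)) i j =
      (-1) ^ (i : ℕ) * ((-1) ^ (j : ℕ) * A (Fin.rev i) (Fin.rev j)) := by
  simp only [Matrix.mul_apply, Jmat_apply_left (k := 2 * n + 1) i, Jmat_apply_right _ j]
  simp
  ring

/-- if `A` is special orthogonal with respect to the symmetric form
`J_{2n+1}` (i.e. `det A = 1` and `Aᵀ J A = J`), then for all index sets `S`, `T`
of equal cardinality, `A_{S,T} = A_{ι(S̄), ι(T̄)}`. -/
theorem orthogonal_minor_identity (n : ℕ) (hn : 1 ≤ n)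
    (A : Matrix (Fin (2 * n + 1)) (Fin (2 * n + 1)) ℂ)
    (hdet : A.det = 1)
    (hA : Aᵀ * Jmat (2 * n + 1) * A = Jmat (2 * n + 1))
    (S T : Finset (Fin (2 * n + 1))) (hST : S.card = T.card) :
    gminor A S T = gminor A (Sᶜ.image Fin.rev) (Tᶜ.image Fin.rev) := by
  have hinv : A * (Jmat (2 * n + 1) * Aᵀ * Jmat (2 * n + 1)) = 1 := by
    rw [mul_eq_one_comm, Matrix.mul_assoc, Matrix.mul_assoc, ← Matrix.mul_assoc Aᵀ, hA,
      Jmat_mul_self]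
  have hST' : Tᶜ.card = Sᶜ.card := by rw [Finset.card_compl, Finset.card_compl, hST]
  have hJ := det_submatrix_inl_of_mul_eq_one hinv (finSumEquivOfFinset rfl rfl)
    (finSumEquivOfFinset hST.symm hST')
  rw [det_submatrix_equiv_equiv, sign_finSumEquivOfFinset_trans_symm, hdet, mul_one] at hJ
  rw [gminor_eq_det_submatrix A rfl hST.symm, gminor_image_rev A rfl hST']
  refine Eq.trans (congrArg det ?_) (hJ.trans ?_)
  · ext i j
    simp
  have hB : (Jmat (2 * n + 1) * Aᵀ * Jmat (2 * n + 1)).submatrix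
      (finSumEquivOfFinset hST.symm hST' ∘ Sum.inr)
      (finSumEquivOfFinset (s := S) rfl rfl ∘ Sum.inr) =
      of fun i j => (-1) ^ (Tᶜ.orderEmbOfFin hST' i : ℕ) *
        (of fun i j => (-1) ^ (Sᶜ.orderEmbOfFin rfl j : ℕ) *
          (A.submatrix (fun i => Fin.rev (Sᶜ.orderEmbOfFin rfl i))
            (fun j => Fin.rev (Tᶜ.orderEmbOfFin hST' j)))ᵀ i j) i j := by
    ext i j
    simp [Jmat_conj_apply]
  rw [hB, det_mul_column, det_mul_row, det_transpose]
  have hsq (f : Fin Sᶜ.card → ℕ) :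
      (∏ j, (-1 : ℂ) ^ f j) * (∏ j, (-1 : ℂ) ^ f j) = 1 := by
    rw [Finset.prod_pow_eq_pow_sum, ← pow_add, ← two_mul, pow_mul]
    simp
  push_cast
  rw [mul_mul_mul_comm, hsq, one_mul, ← mul_assoc, hsq, one_mul]
end

section
/- Let k ≥ 1 and W ∈ M_k(ℂ), and set P = Wᵀ J_k W with entries P_{ij} (1 ≤ i, j ≤ k). Suppose P_{ij} = 0 whenever i + j ≤ k, P_{i,k+1-i} = (-1)^{i-1} for all 1 ≤ i ≤ k, and P_{ij} = 0 whenever i + j = k + 2. Then there exists a unipotent upper-triangular matrix U ∈ M_k(ℂ) such that (WU)ᵀ J_k (WU) = J_k. -/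
open Matrix

open Polynomial in
/-- Truncations of the binomial series of `(1 + X) ^ (-1 / 2)`. -/
theorem exists_sq_mul_one_add_X_eq (n : ℕ) :
    ∃ r q : ℂ[X], (1 + X * r) ^ 2 * (1 + X) = 1 + X ^ (n + 1) * q := by
  induction n with
  | zero => exact ⟨0, 1, by ring⟩
  | succ n ih =>
    obtain ⟨r, q, h⟩ := ih
    obtain ⟨c, q', hq⟩ : ∃ (c : ℂ) (q' : ℂ[X]), q = X * q' - 2 * C c := by
      refine ⟨-(q.coeff 0) / 2, q.divX, ?_⟩
      have hc : (2 : ℂ[X]) * C (-(q.coeff 0) / 2) = -C (q.coeff 0) := by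
        rw [← C_ofNat, ← C_mul, ← C_neg]
        congr 1
        ring
      rw [hc, sub_neg_eq_add, X_mul_divX_add]
    refine ⟨r + C c * X ^ n,
      q' + 2 * C c * (1 + r * (1 + X)) + C c ^ 2 * X ^ n * (1 + X), ?_⟩
    subst hq
    linear_combination h

open Polynomial in
theorem Matrix.BlockTriangular.aeval {R m α : Type*} [CommRing R] [Fintype m] [DecidableEq m]
    [LinearOrder α] {b : m → α} {M : Matrix m m R} (hM : M.BlockTriangular b) (p : R[X]) :
    (Polynomial.aeval M p).BlockTriangular b := by
  induction p using Polynomial.induction_on' with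
  | add p q hp hq =>
    rw [map_add]
    exact hp.add hq
  | monomial n a =>
    rw [aeval_monomial, ← Algebra.smul_def]
    exact fun i j hij => by rw [Matrix.smul_apply, hM.pow n hij, smul_zero]

open Polynomial in
theorem Matrix.transpose_aeval_mul_of_transpose_mul {R m : Type*} [CommRing R] [Fintype m]
    [DecidableEq m] {M B : Matrix m m R} (h : Mᵀ * B = B * M) (p : R[X]) :
    (aeval M p)ᵀ * B = B * aeval M p := by
  induction p using Polynomial.induction_on' with
  | add p q hp hq => rw [map_add, transpose_add, add_mul, mul_add, hp, hq]
  | monomial n a =>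
    have hn : SemiconjBy B (M ^ n) (Mᵀ ^ n) := SemiconjBy.pow_right h.symm n
    rw [aeval_monomial, ← Algebra.smul_def, transpose_smul, transpose_pow, smul_mul_assoc,
      mul_smul_comm, hn.eq]

theorem Matrix.pow_eq_zero_of_strictly_upper {R : Type*} [CommRing R] {k : ℕ}
    {M : Matrix (Fin k) (Fin k) R} (hM : ∀ i j, j ≤ i → M i j = 0) : M ^ k = 0 := by
  have hc : M.charpoly = Polynomial.X ^ k := by
    rw [charpoly_of_isUpperTriangular M fun i j hij => hM i j (le_of_lt hij)]
    simp [hM]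
  simpa [hc] using aeval_self_charpoly M

/-- A unipotent upper-triangular matrix that is self-adjoint for a bilinear form `B` has
an inverse square root with the same properties. -/
theorem exists_unipotent_transpose_mul_mul_eq {k : ℕ} {N B : Matrix (Fin k) (Fin k) ℂ}
    (hN : ∀ i j, j < i → N i j = 0) (hN1 : ∀ i, N i i = 1) (hB : Nᵀ * B = B * N) :
    ∃ U : Matrix (Fin k) (Fin k) ℂ,
      (∀ i j, j < i → U i j = 0) ∧ (∀ i, U i i = 1) ∧ Uᵀ * (B * N) * U = B := by
  obtain ⟨M, rfl⟩ : ∃ M, N = 1 + M := ⟨N - 1, by abel⟩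
  have hM : ∀ i j, j ≤ i → M i j = 0 := by
    intro i j hij
    rcases hij.lt_or_eq with h | rfl
    · simpa [Matrix.one_apply_ne h.ne'] using hN i j h
    · simpa using hN1 j
  have hMB : Mᵀ * B = B * M := by
    simpa [add_mul, mul_add] using hB
  obtain ⟨r, q, hrq⟩ := exists_sq_mul_one_add_X_eq k
  have hM0 : M ^ (k + 1) = 0 := by
    rw [pow_succ, Matrix.pow_eq_zero_of_strictly_upper hM, zero_mul]
  have hS : ∀ i j, j ≤ i → (M * Polynomial.aeval M r) i j = 0 := by
    have hr : (Polynomial.aeval M r).BlockTriangular id :=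
      Matrix.BlockTriangular.aeval (fun i j hij => hM i j (le_of_lt hij)) r
    intro i j hij
    rw [Matrix.mul_apply]
    refine Finset.sum_eq_zero fun l _ => ?_
    rcases le_or_gt l i with h | h
    · rw [hM i l h, zero_mul]
    · rw [hr (show id j < id l from hij.trans_lt h), mul_zero]
  have hT := Matrix.transpose_aeval_mul_of_transpose_mul hMB (1 + Polynomial.X * r)
  refine ⟨Polynomial.aeval M (1 + Polynomial.X * r), fun i j hij => ?_, fun i => ?_, ?_⟩
  · simp [hS i j hij.le, Matrix.one_apply_ne hij.ne']
  · simp [hS i i le_rfl]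
  · have hcomm : (1 + Polynomial.X * r) * (1 + Polynomial.X) * (1 + Polynomial.X * r)
        = 1 + Polynomial.X ^ (k + 1) * q := by
      rw [← hrq]
      ring
    have hone := congrArg (Polynomial.aeval M) hcomm
    rw [map_mul, map_mul, map_add (Polynomial.aeval M) 1 Polynomial.X,
      map_add (Polynomial.aeval M) 1 (_ ^ _ * _), map_mul _ (_ ^ _), map_pow, map_one,
      Polynomial.aeval_X, hM0, zero_mul, add_zero] at hone
    rw [← mul_assoc, hT, mul_assoc, mul_assoc, ← mul_assoc (Polynomial.aeval M _), hone, mul_one]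

theorem Jmat_mul_apply {k : ℕ} (A : Matrix (Fin k) (Fin k) ℂ) (i j : Fin k) :
    (Jmat k * A) i j = (-1) ^ (i : ℕ) * A i.rev j := by
  rw [Matrix.mul_apply, Finset.sum_eq_single i.rev]
  · rw [Jmat, Matrix.of_apply, if_pos (by rw [Fin.val_rev]; lia)]
  · intro l _ hl
    rw [Jmat, Matrix.of_apply, if_neg, zero_mul]
    intro h
    apply hl
    ext
    rw [Fin.val_rev]
    lia
  · simp

theorem neg_one_pow_mul_neg_one_pow_rev {k : ℕ} (i : Fin k) :
    (-1 : ℂ) ^ (i : ℕ) * (-1) ^ (i.rev : ℕ) = (-1) ^ (k - 1) := by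
  rw [← pow_add, Fin.val_rev]
  congr 1
  lia

theorem neg_one_pow_mul_self (n : ℕ) : (-1 : ℂ) ^ n * (-1) ^ n = 1 := by
  rw [← mul_pow]
  simp

theorem Jmat_mul_self_s4 (k : ℕ) : Jmat k * Jmat k = (-1 : ℂ) ^ (k - 1) • 1 := by
  ext i j
  rw [Jmat_mul_apply, Jmat, Matrix.of_apply, Matrix.smul_apply, Matrix.one_apply, Fin.val_rev]
  by_cases h : i = j
  · subst h
    rw [if_pos (by lia), if_pos rfl, smul_eq_mul, mul_one, ← Fin.val_rev,
      neg_one_pow_mul_neg_one_pow_rev]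
  · rw [if_neg (by lia), if_neg h, mul_zero, smul_zero]

theorem Jmat_transpose (k : ℕ) : (Jmat k)ᵀ = (-1 : ℂ) ^ (k - 1) • Jmat k := by
  ext i j
  rw [Matrix.transpose_apply, Matrix.smul_apply, Jmat, Matrix.of_apply, Matrix.of_apply]
  by_cases h : (i : ℕ) + j + 1 = k
  · have hk : k - 1 = i + j := by lia
    rw [if_pos (by lia), if_pos h, hk, pow_add, smul_eq_mul, mul_right_comm,
      neg_one_pow_mul_self, one_mul]
  · rw [if_neg (by lia), if_neg h, smul_zero]

/-- Gram–Schmidt normalization.  Let `P = Wᵀ J_k W`.  If (in 1-indexed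
terms) `P_{ij} = 0` whenever `i + j ≤ k`, `P_{i,k+1-i} = (-1)^(i-1)` for all `i`, and
`P_{ij} = 0` whenever `i + j = k + 2`, then there is a unipotent upper-triangular
matrix `U` with `(WU)ᵀ J_k (WU) = J_k`.  (In the 0-indexed formulation below, the
three conditions read `i + j + 2 ≤ k`, `i + j + 1 = k` and `i + j = k`.) -/
theorem gram_schmidt_normalization (k : ℕ) (hk : 1 ≤ k)
    (W : Matrix (Fin k) (Fin k) ℂ)
    (h0 : ∀ i j : Fin k, (i : ℕ) + (j : ℕ) + 2 ≤ k → (Wᵀ * Jmat k * W) i j = 0)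
    (h1 : ∀ i j : Fin k, (i : ℕ) + (j : ℕ) + 1 = k →
      (Wᵀ * Jmat k * W) i j = (-1 : ℂ) ^ (i : ℕ))
    (h2 : ∀ i j : Fin k, (i : ℕ) + (j : ℕ) = k → (Wᵀ * Jmat k * W) i j = 0) :
    ∃ U : Matrix (Fin k) (Fin k) ℂ,
      (∀ i j : Fin k, j < i → U i j = 0) ∧ (∀ i : Fin k, U i i = 1) ∧
      (W * U)ᵀ * Jmat k * (W * U) = Jmat k := by
  set P := Wᵀ * Jmat k * W with hP
  have hss := neg_one_pow_mul_self (k - 1)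
  have hPT : Pᵀ = (-1 : ℂ) ^ (k - 1) • P := by
    simp [hP, Matrix.transpose_mul, Jmat_transpose, Matrix.mul_assoc]
  have hJN : Jmat k * ((-1 : ℂ) ^ (k - 1) • (Jmat k * P)) = P := by
    rw [mul_smul_comm, ← mul_assoc, Jmat_mul_self_s4, smul_mul_assoc, one_mul, smul_smul, hss,
      one_smul]
  have hN : ∀ i j, j < i → ((-1 : ℂ) ^ (k - 1) • (Jmat k * P)) i j = 0 := by
    intro i j hij
    rw [Matrix.smul_apply, Jmat_mul_apply, h0 _ _ (by rw [Fin.val_rev]; lia), mul_zero, smul_zero]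
  have hN1 : ∀ i, ((-1 : ℂ) ^ (k - 1) • (Jmat k * P)) i i = 1 := by
    intro i
    rw [Matrix.smul_apply, Jmat_mul_apply, h1 _ _ (by rw [Fin.val_rev]; lia),
      neg_one_pow_mul_neg_one_pow_rev, smul_eq_mul, hss]
  have hNJ : ((-1 : ℂ) ^ (k - 1) • (Jmat k * P))ᵀ * Jmat k
      = Jmat k * ((-1 : ℂ) ^ (k - 1) • (Jmat k * P)) := by
    rw [hJN, Matrix.transpose_smul, Matrix.transpose_mul, hPT, Jmat_transpose, smul_mul_smul_comm,
      hss, one_smul, smul_mul_assoc, mul_assoc, Jmat_mul_self_s4, mul_smul_comm, mul_one, smul_smul,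
      hss, one_smul]
  obtain ⟨U, hU, hU1, h⟩ := exists_unipotent_transpose_mul_mul_eq hN hN1 hNJ
  refine ⟨U, hU, hU1, ?_⟩
  rw [hJN, hP] at h
  simpa only [Matrix.transpose_mul, Matrix.mul_assoc] using h
end

section
/- Let k ≥ 1 and let H ∈ M_k(ℂ) be Hermitian positive definite with Hᵀ J_k H = J_k. Let H = B†B be its Cholesky decomposition, where B is lower triangular with strictly positive real diagonal entries and B† denotes the conjugate transpose of B. Then Bᵀ J_k B = J_k. -/
open Matrix
open scoped ComplexOrder

theorem Jmat_apply (k : ℕ) (i j : Fin k) :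
    Jmat k i j = if j = i.rev then (-1 : ℂ) ^ (i : ℕ) else 0 := by
  have h : (i : ℕ) + (j : ℕ) + 1 = k ↔ j = i.rev := by
    rw [Fin.ext_iff, Fin.val_rev]
    omega
  simp only [Jmat, Matrix.of_apply, h]

theorem Jmat_transpose_mul_apply {k : ℕ} (A : Matrix (Fin k) (Fin k) ℂ) (i j : Fin k) :
    ((Jmat k)ᵀ * A) i j = (-1 : ℂ) ^ (i.rev : ℕ) * A i.rev j := by
  have h (l : Fin k) : i = l.rev ↔ l = i.rev := by
    rw [eq_comm, Fin.rev_eq_iff]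
  simp only [Matrix.mul_apply, Matrix.transpose_apply, Jmat_apply, h]
  simp

theorem mul_Jmat_apply {k : ℕ} (A : Matrix (Fin k) (Fin k) ℂ) (i j : Fin k) :
    (A * Jmat k) i j = A i j.rev * (-1 : ℂ) ^ (j.rev : ℕ) := by
  have h (l : Fin k) : j = l.rev ↔ l = j.rev := by
    rw [eq_comm, Fin.rev_eq_iff]
  simp only [Matrix.mul_apply, Jmat_apply, h]
  simp

theorem Jmat_transpose_mul_self (k : ℕ) : (Jmat k)ᵀ * Jmat k = 1 := by
  ext i j
  rw [Jmat_transpose_mul_apply, Jmat_apply, Matrix.one_apply, Fin.rev_rev]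
  by_cases h : i = j
  · simp [h, ← mul_pow]
  · simp [h, Ne.symm h]

theorem Jmat_conjTranspose (k : ℕ) : (Jmat k)ᴴ = (Jmat k)ᵀ := by
  ext i j
  simp only [Matrix.conjTranspose_apply, Matrix.transpose_apply, Jmat_apply]
  split_ifs <;> simp

/-- The diagonal of a product of lower triangular matrices. -/
theorem Matrix.mul_apply_self_of_lowerTriangular {n R : Type*} [Fintype n] [LinearOrder n]
    [NonUnitalNonAssocSemiring R] {A B : Matrix n n R}
    (hA : A.BlockTriangular OrderDual.toDual) (hB : B.BlockTriangular OrderDual.toDual) (i : n) :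
    (A * B) i i = A i i * B i i := by
  rw [Matrix.mul_apply]
  refine Finset.sum_eq_single i (fun j _ hj => ?_) (by simp)
  rcases lt_or_gt_of_ne hj with h | h
  · rw [hB (OrderDual.toDual_lt_toDual.2 h), mul_zero]
  · rw [hA (OrderDual.toDual_lt_toDual.2 h), zero_mul]

/-- A unitary lower triangular matrix with positive diagonal is the identity. -/
theorem Matrix.eq_one_of_lowerTriangular_of_mul_conjTranspose_eq_one {n : Type*} [Fintype n]
    [LinearOrder n] {T : Matrix n n ℂ} (hT : T.BlockTriangular OrderDual.toDual)
    (hpos : ∀ i, 0 < T i i) (h : T * Tᴴ = 1) : T = 1 := by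
  have hinv : T⁻¹ = Tᴴ := Matrix.inv_eq_right_inv h
  have : Invertible T := invertibleOfRightInverse T Tᴴ h
  have hT' : Tᴴ.BlockTriangular OrderDual.toDual :=
    hinv ▸ Matrix.blockTriangular_inv_of_blockTriangular hT
  ext i j
  rcases lt_trichotomy i j with hij | rfl | hij
  · rw [hT (OrderDual.toDual_lt_toDual.2 hij), Matrix.one_apply_ne hij.ne]
  · have hd : T i i * star (T i i) = 1 := by
      rw [← Matrix.conjTranspose_apply, ← Matrix.mul_apply_self_of_lowerTriangular hT hT', h,
        Matrix.one_apply_eq]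
    have hs : star (T i i) = T i i := (IsSelfAdjoint.of_nonneg (hpos i).le).star_eq
    rw [hs] at hd
    rw [Matrix.one_apply_eq]
    rcases mul_self_eq_one_iff.1 hd with h1 | h1
    · exact h1
    · have := hpos i
      rw [h1, Complex.lt_def] at this
      norm_num at this
  · have hz : star (T i j) = 0 := hT' (i := j) (j := i) (OrderDual.toDual_lt_toDual.2 hij)
    rw [star_eq_zero.1 hz, Matrix.one_apply_ne hij.ne']

/-- let `H` be Hermitian positive definite with `Hᵀ J_k H = J_k`, and let
`H = B†B` be its Cholesky decomposition, with `B` lower triangular with strictly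
positive real diagonal entries.  Then `Bᵀ J_k B = J_k`. -/
theorem cholesky_factor_is_symplectic_or_orthogonal (k : ℕ) (hk : 1 ≤ k)
    (H B : Matrix (Fin k) (Fin k) ℂ)
    (hposdef : H.PosDef)
    (hHJ : Hᵀ * Jmat k * H = Jmat k)
    (hBtri : ∀ i j : Fin k, i < j → B i j = 0)
    (hBdiag : ∀ i : Fin k, 0 < (B i i).re ∧ (B i i).im = 0)
    (hchol : H = Bᴴ * B) :
    Bᵀ * Jmat k * B = Jmat k := by
  set U := (Jmat k)ᵀ * Bᵀ * Jmat k with hU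
  have hU_apply : ∀ i j, U i j =
      (-1 : ℂ) ^ (i.rev : ℕ) * B j.rev i.rev * (-1 : ℂ) ^ (j.rev : ℕ) := fun i j => by
    rw [hU, mul_Jmat_apply, Jmat_transpose_mul_apply, Matrix.transpose_apply]
  have hB : B.BlockTriangular OrderDual.toDual :=
    fun i j hij => hBtri i j (OrderDual.toDual_lt_toDual.1 hij)
  have hUtri : U.BlockTriangular OrderDual.toDual := fun i j hij => by
    rw [hU_apply, hBtri _ _ (Fin.rev_lt_rev.2 (OrderDual.toDual_lt_toDual.1 hij)), mul_zero,
      zero_mul]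
  have hBpos : ∀ i, 0 < B i i := fun i =>
    Complex.lt_def.2 ⟨(hBdiag i).1, (hBdiag i).2.symm⟩
  have hU_diag : ∀ i, U i i = B i.rev i.rev := fun i => by
    rw [hU_apply, mul_right_comm, ← mul_pow]
    simp
  have hJ := Jmat_transpose_mul_self k
  have hJ' : Jmat k * (Jmat k)ᵀ = 1 := mul_eq_one_comm.1 hJ
  have hUstar : Uᴴ = (Jmat k)ᵀ * Bᵀᴴ * Jmat k := by
    rw [hU, Matrix.conjTranspose_mul, Matrix.conjTranspose_mul,
      ← Jmat_conjTranspose, Matrix.conjTranspose_conjTranspose, Matrix.mul_assoc]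
  have hHT : Hᵀ = Bᵀ * Bᵀᴴ := by
    rw [hchol, Matrix.transpose_mul]
    rfl
  have hprod : (U * Uᴴ * Bᴴ) * B = 1 := by
    calc (U * Uᴴ * Bᴴ) * B
        = (Jmat k)ᵀ * (Bᵀ * (Jmat k * (Jmat k)ᵀ) * Bᵀᴴ * Jmat k * (Bᴴ * B)) := by
          rw [hUstar, hU]
          simp only [Matrix.mul_assoc]
      _ = 1 := by rw [hJ', Matrix.mul_one, ← hHT, ← hchol, hHJ, hJ]
  have hT : B * U = 1 := by
    refine Matrix.eq_one_of_lowerTriangular_of_mul_conjTranspose_eq_one (hB.mul hUtri)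
      (fun i => ?_) ?_
    · rw [Matrix.mul_apply_self_of_lowerTriangular hB hUtri, hU_diag]
      exact mul_pos (hBpos _) (hBpos _)
    · rw [Matrix.conjTranspose_mul, Matrix.mul_assoc, ← Matrix.mul_assoc U]
      exact mul_eq_one_comm.1 hprod
  calc Bᵀ * Jmat k * B = Jmat k * (Jmat k)ᵀ * (Bᵀ * Jmat k * B) := by rw [hJ', Matrix.one_mul]
    _ = Jmat k * (U * B) := by
      rw [hU]
      simp only [Matrix.mul_assoc]
    _ = Jmat k := by rw [mul_eq_one_comm.1 hT, Matrix.mul_one]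
end

section
/- Let n ≥ 2. Let A^B = (a_{ij}) be the n×n Cartan matrix of type B_n: a_{ii} = 2; a_{i,i+1} = −1 for 1 ≤ i ≤ n−2; a_{n−1,n} = −2; a_{i,i−1} = −1 for 2 ≤ i ≤ n; all other entries 0. Let Ã = (ã_{ij}) be the 2n×2n Cartan matrix of type A_{2n}: ã_{ii} = 2, ã_{i,i±1} = −1, all other entries 0. Suppose γ, α ∈ ℝ^n satisfy ∑_{j=1}^n a_{ij} α_j = γ_i for all 1 ≤ i ≤ n. Define γ̃, α̃ ∈ ℝ^{2n} by γ̃_i = γ_{σ(i)} and α̃_i = (1 + δ_{σ(i),n}) α_{σ(i)}, where σ(i) = min(i, 2n+1−i) and δ is the Kronecker delta. Then ∑_{j=1}^{2n} ã_{ij} α̃_j = γ̃_i for all 1 ≤ i ≤ 2n. -/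
/-- The Cartan matrix of type `A_m` (0-indexed entries). -/
noncomputable def cartanA (m : ℕ) : Matrix (Fin m) (Fin m) ℝ :=
  Matrix.of fun i j =>
    if i = j then 2
    else if (j : ℕ) = (i : ℕ) + 1 ∨ (i : ℕ) = (j : ℕ) + 1 then -1
    else 0

/-- The Cartan matrix of type `B_n` (0-indexed entries): the entry in (1-indexed)
position `(n-1, n)` is `-2`, the other sub/super-diagonal entries are `-1`. -/
noncomputable def cartanB (n : ℕ) : Matrix (Fin n) (Fin n) ℝ :=
  Matrix.of fun i j =>
    if i = j then 2
    else if (j : ℕ) = (i : ℕ) + 1 then (if (j : ℕ) = n - 1 then -2 else -1)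
    else if (i : ℕ) = (j : ℕ) + 1 then -1
    else 0

theorem sum_ite_val_eq {m : ℕ} (k : ℕ) (f : Fin m → ℝ) :
    ∑ j : Fin m, (if (j : ℕ) = k then f j else 0) = if h : k < m then f ⟨k, h⟩ else 0 := by
  split_ifs with h
  · rw [Finset.sum_eq_single ⟨k, h⟩]
    · simp
    · intro b _ hb
      rw [if_neg fun e => hb (Fin.ext e)]
    · simp
  · exact Finset.sum_eq_zero fun j _ => if_neg (by omega)

/-- A row of a matrix supported on the three central diagonals has at most three terms. -/
theorem sum_tridiagonal {m : ℕ} (i : Fin m) (f : Fin m → ℝ)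
    (hf : ∀ j : Fin m, j ≠ i → (j : ℕ) ≠ i + 1 → (i : ℕ) ≠ j + 1 → f j = 0) :
    ∑ j, f j = f i + (if h : (i : ℕ) + 1 < m then f ⟨i + 1, h⟩ else 0)
      + (if 0 < (i : ℕ) then f ⟨i - 1, by omega⟩ else 0) := by
  have hsplit : ∀ j : Fin m, f j = (if (j : ℕ) = i then f j else 0)
      + (if (j : ℕ) = i + 1 then f j else 0)
      + (if (j : ℕ) = i - 1 then (if 0 < (i : ℕ) then f j else 0) else 0) := by
    intro j
    have := hf j
    rw [ne_eq, Fin.ext_iff] at this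
    split_ifs <;> first | omega | (simp; done) | (rw [this] <;> first | omega | simp)
  rw [Finset.sum_congr rfl fun j _ => hsplit j, Finset.sum_add_distrib, Finset.sum_add_distrib,
    sum_ite_val_eq, sum_ite_val_eq, sum_ite_val_eq, dif_pos i.isLt,
    dif_pos (show (i : ℕ) - 1 < m by omega)]

theorem cartanA_sum {m : ℕ} (i : Fin m) (f : Fin m → ℝ) :
    ∑ j, cartanA m i j * f j = 2 * f i - (if h : (i : ℕ) + 1 < m then f ⟨i + 1, h⟩ else 0)
      - (if 0 < (i : ℕ) then f ⟨i - 1, by omega⟩ else 0) := by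
  rw [sum_tridiagonal i]
  · simp only [cartanA, Matrix.of_apply, Fin.ext_iff]
    split_ifs <;> first | omega | ring1 | tauto
  · intro j h₁ h₂ h₃
    simp [cartanA, h₁.symm, h₂, h₃]

theorem cartanB_sum {n : ℕ} (i : Fin n) (f : Fin n → ℝ) :
    ∑ j, cartanB n i j * f j = 2 * f i
      - (if h : (i : ℕ) + 1 < n then (if (i : ℕ) + 1 = n - 1 then 2 else 1) * f ⟨i + 1, h⟩ else 0)
      - (if 0 < (i : ℕ) then f ⟨i - 1, by omega⟩ else 0) := by
  rw [sum_tridiagonal i]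
  · simp only [cartanB, Matrix.of_apply, Fin.ext_iff]
    split_ifs <;> first | omega | ring1
  · intro j h₁ h₂ h₃
    simp [cartanB, h₁.symm, h₂, h₃]

/-- if `A^B α = γ` for the Cartan matrix of type `B_n`, and
`γ̃_i = γ_{σ(i)}`, `α̃_i = (1 + δ_{σ(i),n}) α_{σ(i)}` with `σ(i) = min(i, 2n+1−i)`
(1-indexed; 0-indexed `σ(i) = min(i, 2n−1−i)` and the Kronecker condition reads
`σ(i) = n−1`), then `Ã α̃ = γ̃` for the Cartan matrix of type `A_{2n}`. -/
theorem toda_B_parameters_reduction (n : ℕ) (hn : 2 ≤ n)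
    (γ α : Fin n → ℝ)
    (h : ∀ i : Fin n, ∑ j : Fin n, cartanB n i j * α j = γ i)
    (σ : Fin (2 * n) → Fin n)
    (hσ : ∀ i, (σ i : ℕ) = min (i : ℕ) (2 * n - 1 - (i : ℕ))) :
    ∀ i : Fin (2 * n),
      ∑ j : Fin (2 * n), cartanA (2 * n) i j *
          ((if (σ j : ℕ) = n - 1 then 2 else 1) * α (σ j))
        = γ (σ i) := by
  intro i
  have hi := i.isLt
  obtain ⟨a, ha⟩ : ∃ a : ℕ → ℝ, ∀ j : Fin n, α j = a j :=
    ⟨fun k => if hk : k < n then α ⟨k, hk⟩ else 0, fun j => by simp⟩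
  rw [cartanA_sum, ← h, cartanB_sum]
  simp only [ha, hσ]
  rcases Nat.lt_or_ge i n with hlt | hge
  · have e₀ : min (i : ℕ) (2 * n - 1 - i) = i := by omega
    have e₂ : min ((i : ℕ) - 1) (2 * n - 1 - (i - 1)) = i - 1 := by omega
    rw [e₀, e₂]
    rcases Nat.lt_or_ge (i + 1) n with hlt' | hge'
    · have e₁ : min ((i : ℕ) + 1) (2 * n - 1 - (i + 1)) = i + 1 := by omega
      rw [e₁]
      split_ifs <;> first | omega | ring1
    · have e₁ : min ((i : ℕ) + 1) (2 * n - 1 - (i + 1)) = i := by omega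
      rw [e₁]
      split_ifs <;> first | omega | ring1
  · obtain ⟨k, hk⟩ : ∃ k, k = 2 * n - 1 - (i : ℕ) := ⟨_, rfl⟩
    have e₀ : min (i : ℕ) (2 * n - 1 - i) = k := by omega
    have e₁ : min ((i : ℕ) + 1) (2 * n - 1 - (i + 1)) = k - 1 := by omega
    rw [e₀, e₁]
    rcases Nat.lt_or_ge (k + 1) n with hlt' | hge'
    · have e₂ : min ((i : ℕ) - 1) (2 * n - 1 - (i - 1)) = k + 1 := by omega
      rw [e₂]
      split_ifs <;> first | omega | ring1
    · have e₂ : min ((i : ℕ) - 1) (2 * n - 1 - (i - 1)) = k := by omega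
      rw [e₂]
      split_ifs <;> first | omega | ring1
end
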